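/- arXiv:math/0510484 — 3 statements merged into one kernel-verified Lean document; each statement's English description precedes it below -/
import Mathlib

section
/- If every simple P-filter on ℕ is meager, then every topological space with the property Ufin(𝒪,T*) has the Hurewicz property Ufin(𝒪,Γ). -/
open Set Cardinal

/-- `A ⊆* B` : almost inclusion, i.e. `A \ B` is finite. -/
def AlmostSub (A B : Set ℕ) : Prop := (A \ B).Finite

/-- The Marczewski map: `mu u x = {n | x ∈ u n}`. -/
def mu {X : Type*} (u : ℕ → Set X) (x : X) : Set ℕ := {n | x ∈ u n}

/-- `u` is a γ-cover: every `mu u x` is cofinite. -/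
def IsGammaCover {X : Type*} (u : ℕ → Set X) : Prop :=
  ∀ x : X, (mu u x)ᶜ.Finite

/-- `u` is an ω-cover: the family `mu u '' X` is centered. -/
def IsOmegaCover {X : Type*} (u : ℕ → Set X) : Prop :=
  ∀ K : Finset X, (⋂ x ∈ K, mu u x).Infinite

/-- `u` is a τ-cover. -/
def IsTauCover {X : Type*} (u : ℕ → Set X) : Prop :=
  (∀ x : X, (mu u x).Infinite) ∧
  ∀ x₁ x₂ : X, AlmostSub (mu u x₁) (mu u x₂) ∨ AlmostSub (mu u x₂) (mu u x₁)

/-- A family of sets of naturals is linearly preordered by `⊆*`. -/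
def LinearAlmost (J : Set (Set ℕ)) : Prop :=
  ∀ A ∈ J, ∀ B ∈ J, AlmostSub A B ∨ AlmostSub B A

/-- `u` is a τ*-cover: some family `J` of infinite subsets of `ℕ`, linearly
preordered by `⊆*`, refines `mu u '' X`. -/
def IsTauAstCover {X : Type*} (u : ℕ → Set X) : Prop :=
  ∃ J : Set (Set ℕ), (∀ A ∈ J, A.Infinite) ∧ LinearAlmost J ∧
    ∀ x : X, ∃ A ∈ J, A ⊆ mu u x

/-- `u` is a τ⋆-cover: some family `J ⊆ mu u '' X` of infinite subsets of `ℕ`,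
linearly preordered by `⊆*`, refines `mu u '' X`. -/
def IsTauStarCover {X : Type*} (u : ℕ → Set X) : Prop :=
  ∃ J : Set (Set ℕ), J ⊆ Set.range (mu u) ∧ (∀ A ∈ J, A.Infinite) ∧ LinearAlmost J ∧
    ∀ x : X, ∃ A ∈ J, A ⊆ mu u x

/-- An open cover of the whole space. -/
def IsOpenCover {X : Type*} [TopologicalSpace X] (u : Set (Set X)) : Prop :=
  (∀ U ∈ u, IsOpen U) ∧ ⋃₀ u = Set.univ

/-- The selection principle `Ufin(O, P)` : for every sequence of open covers `u n`
there are finite `v n ⊆ u n` such that the sequence `n ↦ ⋃₀ v n` satisfies `P`. -/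
def Ufin (X : Type*) [TopologicalSpace X] (P : (ℕ → Set X) → Prop) : Prop :=
  ∀ u : ℕ → Set (Set X), (∀ n, IsOpenCover (u n)) →
    ∃ v : ℕ → Set (Set X), (∀ n, (v n).Finite ∧ v n ⊆ u n) ∧ P (fun n => ⋃₀ v n)

/-- The Menger property `Ufin(O,O)`. -/
def UfinO (X : Type*) [TopologicalSpace X] : Prop :=
  Ufin X (fun w => ∀ x : X, ∃ n, x ∈ w n)

/-- The Hurewicz property `Ufin(O,Γ)`. -/
def UfinGamma (X : Type*) [TopologicalSpace X] : Prop := Ufin X IsGammaCover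

/-- `Ufin(O,Ω)`. -/
def UfinOmega (X : Type*) [TopologicalSpace X] : Prop := Ufin X IsOmegaCover

/-- `Ufin(O,T)`. -/
def UfinTau (X : Type*) [TopologicalSpace X] : Prop := Ufin X IsTauCover

/-- `Ufin(O,T*)`. -/
def UfinTauAst (X : Type*) [TopologicalSpace X] : Prop := Ufin X IsTauAstCover

/-- `Ufin(O,T⋆)`. -/
def UfinTauStar (X : Type*) [TopologicalSpace X] : Prop := Ufin X IsTauStarCover

/-- The upward `⊆*`-closure of a family of subsets of `ℕ`. -/
def upCl (A : Set (Set ℕ)) : Set (Set ℕ) := {B | ∃ a ∈ A, AlmostSub a B}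

/-- A semifilter on `ℕ`. -/
def IsSemifilter (F : Set (Set ℕ)) : Prop :=
  (∀ A ∈ F, A.Nonempty) ∧ ∀ A ∈ F, ∀ B : Set ℕ, AlmostSub A B → B ∈ F

/-- A filter on `ℕ` (in the semifilter sense): a semifilter closed under finite
intersections. -/
def IsFilterFam (F : Set (Set ℕ)) : Prop :=
  IsSemifilter F ∧ ∀ A ∈ F, ∀ B ∈ F, A ∩ B ∈ F

/-- A simple P-filter: a filter consisting of infinite sets with a base linearly
preordered by `⊆*`. -/
def IsSimplePFilter (F : Set (Set ℕ)) : Prop :=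
  IsFilterFam F ∧ (∀ A ∈ F, A.Infinite) ∧
  ∃ B : Set (Set ℕ), B ⊆ F ∧ F = upCl B ∧ LinearAlmost B

/-- A family of subsets of `ℕ` is meager if the corresponding set of
characteristic functions is meager in the Cantor space `ℕ → Bool`. -/
def MeagerFam (F : Set (Set ℕ)) : Prop :=
  IsMeagre {f : ℕ → Bool | {n | f n = true} ∈ F}

/-- A family of subsets of `ℕ` is comeager if the corresponding set of
characteristic functions is comeager in the Cantor space `ℕ → Bool`. -/
def ComeagerFam (F : Set (Set ℕ)) : Prop :=
  {f : ℕ → Bool | {n | f n = true} ∈ F} ∈ residual (ℕ → Bool)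

/-- `x ≤* y` : eventual dominance. -/
def evLE (x y : ℕ → ℕ) : Prop := {n | y n < x n}.Finite

/-- The unbounding number `𝔟`. -/
noncomputable def cardB : Cardinal :=
  sInf {c | ∃ S : Set (ℕ → ℕ), c = #S ∧ ¬ ∃ y : ℕ → ℕ, ∀ x ∈ S, evLE x y}

/-- The dominating number `𝔡`. -/
noncomputable def cardD : Cardinal :=
  sInf {c | ∃ S : Set (ℕ → ℕ), c = #S ∧ ∀ x : ℕ → ℕ, ∃ y ∈ S, evLE x y}

/-- The ultrafilter number `𝔲`. -/
noncomputable def cardU : Cardinal :=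
  sInf {c | ∃ (U : Ultrafilter ℕ) (B : Set (Set ℕ)), c = #B ∧
    (∀ A ∈ U, A.Infinite) ∧ (∀ b ∈ B, b ∈ U) ∧ ∀ A ∈ U, ∃ b ∈ B, b ⊆ A}

/-- A groupwise dense family of infinite subsets of `ℕ`. -/
def IsGroupwiseDense (G : Set (Set ℕ)) : Prop :=
  (∀ A ∈ G, A.Infinite) ∧
  (∀ A ∈ G, ∀ B : Set ℕ, B.Infinite → B ⊆ A → B ∈ G) ∧
  ∀ k : ℕ → ℕ, StrictMono k →
    ∃ S : Set ℕ, S.Infinite ∧ (⋃ n ∈ S, Set.Ico (k n) (k (n + 1))) ∈ G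

/-- The groupwise density number `𝔤`. -/
noncomputable def cardG : Cardinal :=
  sInf {c | ∃ 𝒢 : Set (Set (Set ℕ)), c = #𝒢 ∧ (∀ G ∈ 𝒢, IsGroupwiseDense G) ∧ ⋂₀ 𝒢 = ∅}

/-- A tower of length `lam`: a `⊆*`-decreasing transfinite sequence of infinite
subsets of `ℕ` indexed by the ordinals below `lam`. -/
def IsTower (lam : Ordinal) (T : Ordinal → Set ℕ) : Prop :=
  (∀ α < lam, (T α).Infinite) ∧
  ∀ β α : Ordinal, β ≤ α → α < lam → AlmostSub (T α) (T β)

/-- `Depth⁺([ω]^{ℵ₀})`: the least cardinal `κ` such that there is no tower of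
length `κ`. -/
noncomputable def depthPlus : Cardinal :=
  sInf {c : Cardinal | ¬ ∃ T : Ordinal → Set ℕ, IsTower c.ord T}

/-- The tower number `𝔱`: the least length of a tower with no infinite
pseudo-intersection. -/
noncomputable def cardT : Cardinal :=
  sInf {c : Cardinal | ∃ T : Ordinal → Set ℕ, IsTower c.ord T ∧
    ¬ ∃ A : Set ℕ, A.Infinite ∧ ∀ α < c.ord, AlmostSub A (T α)}

/-- The trace of a family on the intervals determined by `k`. -/
def intervalTrace (k : ℕ → ℕ) (F : Set (Set ℕ)) : Set (Set ℕ) :=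
  {S | ∃ A ∈ F, S = {n | (A ∩ Set.Ico (k n) (k (n + 1))).Nonempty}}

/-- The Filter Dichotomy principle. -/
def FilterDichotomy : Prop :=
  ∀ F U : Set (Set ℕ), IsFilterFam F → IsFilterFam U →
    ¬ MeagerFam F → ¬ ComeagerFam F → ¬ MeagerFam U → ¬ ComeagerFam U →
    ∃ k : ℕ → ℕ, StrictMono k ∧ intervalTrace k F = intervalTrace k U

/-- `B` is `u`-bounded: `B` is contained in the union of a finite subfamily of `u`. -/
def BoundedBy {X : Type*} (u : Set (Set X)) (B : Set X) : Prop :=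
  ∃ v : Set (Set X), v ⊆ u ∧ v.Finite ∧ B ⊆ ⋃₀ v

/-- The weak excluded middle property of a subset of the Baire space. -/
def WeakExcludedMiddle (Z : Set (ℕ → ℕ)) : Prop :=
  ∃ x : ℕ → ℕ, ∃ F : Set (Set ℕ), IsSimplePFilter F ∧ ∀ z ∈ Z, {n | z n ≤ x n} ∈ F

/-- The upward closure of a linearly preordered family of infinite sets is a simple P-filter. -/
theorem LinearAlmost.isSimplePFilter_upCl {J : Set (Set ℕ)} (hinf : ∀ A ∈ J, A.Infinite)
    (hlin : LinearAlmost J) : IsSimplePFilter (upCl J) := by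
  have hup : ∀ A ∈ upCl J, A.Infinite := by
    rintro A ⟨a, ha, haA⟩ hA
    exact hinf a ha ((haA.union hA).subset fun n hn => by
      by_cases h : n ∈ A
      · exact Or.inr h
      · exact Or.inl ⟨hn, h⟩)
  have hinter : ∀ {a b A B : Set ℕ}, AlmostSub a b → AlmostSub a A → AlmostSub b B →
      AlmostSub a (A ∩ B) := by
    intro a b A B hab haA hbB
    refine ((hab.union haA).union hbB).subset fun n hn => ?_
    simp only [mem_union, mem_sdiff, mem_inter_iff] at hn ⊢
    tauto
  refine ⟨⟨⟨fun A hA => (hup A hA).nonempty, ?_⟩, ?_⟩, hup, J, ?_, rfl, hlin⟩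
  · rintro A ⟨a, ha, haA⟩ B hAB
    refine ⟨a, ha, (haA.union hAB).subset fun n hn => ?_⟩
    simp only [mem_union, mem_sdiff] at hn ⊢
    tauto
  · rintro A ⟨a, ha, haA⟩ B ⟨b, hb, hbB⟩
    rcases hlin a ha b hb with hab | hba
    · exact ⟨a, ha, hinter hab haA hbB⟩
    · exact ⟨b, hb, inter_comm A B ▸ hinter hba hbB haA⟩
  · exact fun A hA => ⟨A, hA, by simp [AlmostSub]⟩

/-- Past any position `k`, some finite pattern forces membership in a given dense open subset of
the Cantor space, regardless of the values before `k`. -/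
theorem exists_pattern_of_isOpen_of_dense {D : Set (ℕ → Bool)} (ho : IsOpen D) (hd : Dense D)
    (k : ℕ) : ∃ (l : ℕ) (s : ℕ → Bool), k < l ∧
      ∀ y : ℕ → Bool, (∀ i ∈ Ico k l, y i = s i) → y ∈ D := by
  let H : (Fin k → Bool) → ℕ → Bool := fun a n => if hn : n < k then a ⟨n, hn⟩ else false
  let flip : (ℕ → Bool) → (ℕ → Bool) ≃ₜ (ℕ → Bool) := fun h =>
    { toFun := fun y n => xor (y n) (h n)
      invFun := fun y n => xor (y n) (h n)
      left_inv := fun y => by ext n; simp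
      right_inv := fun y => by ext n; simp
      continuous_toFun := continuous_pi fun n =>
        (continuous_of_discreteTopology (f := fun b : Bool => xor b (h n))).comp
          (continuous_apply n)
      continuous_invFun := continuous_pi fun n =>
        (continuous_of_discreteTopology (f := fun b : Bool => xor b (h n))).comp
          (continuous_apply n) }
  have hopen : ∀ a, IsOpen (flip (H a) ⁻¹' D) := fun a => ho.preimage (flip (H a)).continuous
  obtain ⟨s, hs⟩ := (dense_iInter_of_isOpen hopen
    fun a => hd.preimage (flip (H a)).isOpenMap).nonempty
  obtain ⟨I, t, hI, hsub⟩ := isOpen_pi_iff.mp (isOpen_iInter_of_finite hopen) s hs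
  refine ⟨max k (I.sup id) + 1, s, by omega, fun y hy => ?_⟩
  let a : Fin k → Bool := fun i => xor (y i) (s i)
  have hmem : flip (H a) y ∈ (I : Set ℕ).pi t := by
    intro i hi
    have hle : i ≤ I.sup id := Finset.le_sup (f := id) hi
    have heq : flip (H a) y i = s i := by
      by_cases hik : i < k
      · simp [flip, H, a, hik]
      · simpa [flip, H, hik] using hy i ⟨by omega, by omega⟩
    rw [heq]
    exact (hI i hi).2
  have hD : flip (H a) (flip (H a) y) ∈ D := mem_iInter.mp (hsub hmem) a
  rwa [show flip (H a) (flip (H a) y) = y from (flip (H a)).left_inv y] at hD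

/-- Talagrand's theorem: for a meager family closed under supersets there is an interval
partition of `ℕ` such that each member of the family meets all but finitely many intervals. -/
theorem MeagerFam.exists_strictMono {F : Set (Set ℕ)} (hF : MeagerFam F)
    (hup : ∀ A ∈ F, ∀ B : Set ℕ, A ⊆ B → B ∈ F) :
    ∃ k : ℕ → ℕ, StrictMono k ∧
      ∀ A ∈ F, {n | ¬ (A ∩ Ico (k n) (k (n + 1))).Nonempty}.Finite := by
  obtain ⟨S, hSo, hSd, hSc, hS⟩ := mem_residual_iff.mp hF
  obtain ⟨O, hO⟩ : ∃ O : ℕ → Set (ℕ → Bool), insert Set.univ S = range O :=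
    (hSc.insert Set.univ).exists_eq_range (insert_nonempty _ _)
  have hOprop : ∀ n, IsOpen (O n) ∧ Dense (O n) := by
    intro n
    rcases (hO ▸ mem_range_self n : O n ∈ insert Set.univ S) with h | h
    · rw [h]
      exact ⟨isOpen_univ, dense_univ⟩
    · exact ⟨hSo _ h, hSd _ h⟩
  have hDo : ∀ n, IsOpen (⋂ i : Fin (n + 1), O i) := fun n =>
    isOpen_iInter_of_finite fun i => (hOprop i).1
  have hDd : ∀ n, Dense (⋂ i : Fin (n + 1), O i) := fun n =>
    dense_iInter_of_isOpen (fun i => (hOprop i).1) fun i => (hOprop i).2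
  choose l s hl hs using fun n => exists_pattern_of_isOpen_of_dense (hDo n) (hDd n)
  obtain ⟨k, hkl⟩ : ∃ k : ℕ → ℕ, ∀ n, k (n + 1) = l n (k n) :=
    ⟨fun n => Nat.rec 0 (fun n m => l n m) n, fun _ => rfl⟩
  have hk : StrictMono k := strictMono_nat_of_lt_succ fun n => hkl n ▸ hl n (k n)
  refine ⟨k, hk, fun A hA => ?_⟩
  by_contra hinf
  set M : Set ℕ := {n | ¬ (A ∩ Ico (k n) (k (n + 1))).Nonempty}
  let B : Set ℕ := A ∪ {i | ∃ n ∈ M, i ∈ Ico (k n) (k (n + 1)) ∧ s n (k n) i = true}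
  have hB : B ∈ F := hup A hA B subset_union_left
  let y : ℕ → Bool := B.boolIndicator
  have hy : y ∈ ⋂₀ S := by
    intro t ht
    obtain ⟨j, rfl⟩ : t ∈ range O := hO ▸ mem_insert_of_mem _ ht
    obtain ⟨n, hn, hjn⟩ := Set.Infinite.exists_gt hinf j
    refine mem_iInter.mp (hs n (k n) y fun i hi => ?_) (⟨j, by omega⟩ : Fin (n + 1))
    rw [← hkl] at hi
    have hiA : i ∉ A := fun h => hn ⟨i, h, hi⟩
    have huniq : ∀ m, i ∈ Ico (k m) (k (m + 1)) → m = n := by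
      intro m hm
      have h₁ := hk.lt_iff_lt.mp (hm.1.trans_lt hi.2)
      have h₂ := hk.lt_iff_lt.mp (hi.1.trans_lt hm.2)
      omega
    have hiff : i ∈ B ↔ s n (k n) i = true := by
      constructor
      · rintro (h | ⟨m, -, hm, h⟩)
        · exact absurd h hiA
        · rwa [huniq m hm] at h
      · exact fun h => Or.inr ⟨n, hn, hi, h⟩
    rw [Bool.eq_iff_iff, ← mem_iff_boolIndicator, hiff]
  exact hS hy (show {i | y i = true} ∈ F by simpa [y, ← mem_iff_boolIndicator] using hB)

/-- If every simple P-filter on `ℕ` is meager, then every space with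
`Ufin(O,T*)` has the Hurewicz property `Ufin(O,Γ)`. -/
theorem stmt_2 (h : ∀ F : Set (Set ℕ), IsSimplePFilter F → MeagerFam F) :
    ∀ (X : Type*) [TopologicalSpace X], UfinTauAst X → UfinGamma X := by
  intro X _ hX u hu
  let w : ℕ → Set (Set X) := fun n => {W | IsOpen W ∧ ∀ i ≤ n, ∃ U ∈ u i, W ⊆ U}
  have hw : ∀ n, IsOpenCover (w n) := by
    refine fun n => ⟨fun W hW => hW.1, eq_univ_of_forall fun x => ?_⟩
    have hx : ∀ i, ∃ U ∈ u i, x ∈ U := fun i => by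
      rw [← mem_sUnion, (hu i).2]
      trivial
    choose U hU hxU using hx
    exact ⟨⋂ i ∈ Iic n, U i,
      ⟨(finite_Iic n).isOpen_biInter fun i _ => (hu i).1 _ (hU i),
        fun i hi => ⟨U i, hU i, biInter_subset_of_mem hi⟩⟩,
      mem_iInter₂.mpr fun i _ => hxU i⟩
  obtain ⟨v, hv, J, hJinf, hJlin, hJ⟩ := hX w hw
  have hP := hJlin.isSimplePFilter_upCl hJinf
  obtain ⟨k, hk, hkF⟩ := (h _ hP).exists_strictMono fun A hA B hAB =>
    hP.1.1.2 A hA B (by simp [AlmostSub, sdiff_eq_empty.mpr hAB])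
  have href : ∀ n W, ∃ U, (∃ i, n ≤ i ∧ W ∈ v i) → U ∈ u n ∧ W ⊆ U := by
    intro n W
    by_cases hW : ∃ i, n ≤ i ∧ W ∈ v i
    · obtain ⟨i, hi, hWi⟩ := hW
      obtain ⟨U, hU, hWU⟩ := ((hv i).2 hWi).2 n hi
      exact ⟨U, fun _ => ⟨hU, hWU⟩⟩
    · exact ⟨∅, fun h => absurd h hW⟩
  choose r hr using href
  refine ⟨fun n => r n '' ⋃ i ∈ Ico (k n) (k (n + 1)), v i, fun n => ⟨?_, ?_⟩, fun x => ?_⟩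
  · exact ((finite_Ico _ _).biUnion fun i _ => (hv i).1).image _
  · rintro _ ⟨W, hW, rfl⟩
    obtain ⟨i, hi, hWi⟩ := mem_iUnion₂.mp hW
    exact (hr n W ⟨i, hk.le_apply.trans hi.1, hWi⟩).1
  · obtain ⟨A, hA, hAx⟩ := hJ x
    refine (hkF A ⟨A, hA, by simp [AlmostSub]⟩).subset fun n hn hne => hn ?_
    obtain ⟨i, hiA, hi⟩ := hne
    obtain ⟨W, hWi, hxW⟩ := hAx hiA
    exact ⟨r n W, ⟨W, mem_iUnion₂.mpr ⟨i, hi, hWi⟩, rfl⟩,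
      (hr n W ⟨i, hk.le_apply.trans hi.1, hWi⟩).2 hxW⟩
end

section
/- If there exists a nonmeager simple P-filter on ℕ, then there is a subspace of the Baire space ℕ^ℕ which has the property Ufin(𝒪,T*) but fails the Hurewicz property Ufin(𝒪,Γ). -/
open Set Cardinal

lemma evLE_iff {x y : ℕ → ℕ} : evLE x y ↔ ∀ᶠ n in Filter.cofinite, x n ≤ y n := by
  simp [evLE, Filter.eventually_cofinite]

/-- A well-ordered index type carrying an unbounded family of functions, such that families
indexed by proper initial segments are bounded. -/
lemma exists_unbounded_wellOrder :
    ∃ (ι : Type) (_ : LinearOrder ι) (_ : WellFoundedLT ι),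
      (∀ (f : ι → ℕ → ℕ) (i : ι), ∃ b, ∀ j < i, evLE (f j) b) ∧
      ∃ f : ι → ℕ → ℕ, ¬ ∃ b, ∀ i, evLE (f i) b := by
  let C : Set Cardinal.{0} :=
    {c | ∃ S : Set (ℕ → ℕ), c = #S ∧ ¬ ∃ y : ℕ → ℕ, ∀ x ∈ S, evLE x y}
  have hC : C.Nonempty := by
    refine ⟨_, Set.univ, rfl, ?_⟩
    rintro ⟨y, hy⟩
    have h := hy (fun n => y n + 1) trivial
    simp only [evLE, Nat.lt_succ_self, Set.ofPred_true] at h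
    exact Set.infinite_univ h
  obtain ⟨S, hS, hSu⟩ := csInf_mem hC
  have hmin : ∀ T : Set (ℕ → ℕ), #T < #S → ∃ y : ℕ → ℕ, ∀ x ∈ T, evLE x y := by
    intro T hT
    by_contra hcon
    have : sInf C ≤ #T := csInf_le' ⟨T, rfl, hcon⟩
    rw [hS] at this
    exact absurd hT (not_lt.2 this)
  have hcard : #((#S).ord.ToType) = #S := by simp
  obtain ⟨e⟩ := Cardinal.eq.1 hcard
  refine ⟨(#S).ord.ToType, inferInstance, inferInstance, ?_, fun i => (e i : ℕ → ℕ), ?_⟩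
  · intro f i
    have hlt : #(f '' Set.Iio i) < #S :=
      Cardinal.mk_image_le.trans_lt ((Cardinal.mk_Iio_lt i (by simp)).trans_eq hcard)
    obtain ⟨b, hb⟩ := hmin _ hlt
    exact ⟨b, fun j hj => hb _ ⟨j, hj, rfl⟩⟩
  · rintro ⟨b, hb⟩
    refine hSu ⟨b, fun x hx => ?_⟩
    simpa using hb (e.symm ⟨x, hx⟩)

/-- A family indexed by a well-order whose initial segments are bounded lies pointwise below
a `≤*`-increasing one. -/
lemma exists_evLE_increasing {ι : Type*} [LinearOrder ι] [WellFoundedLT ι]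
    (hb : ∀ (f : ι → ℕ → ℕ) (i : ι), ∃ b, ∀ j < i, evLE (f j) b) (f : ι → ℕ → ℕ) :
    ∃ g : ι → ℕ → ℕ, (∀ i n, f i n ≤ g i n) ∧ ∀ j i, j ≤ i → evLE (g j) (g i) := by
  choose b hb using hb
  let Φ : ∀ i : ι, (∀ j : ι, j < i → ℕ → ℕ) → ℕ → ℕ := fun i r n =>
    max (f i n) (b (fun j => if h : j < i then r j h else 0) i n)
  let g : ι → ℕ → ℕ := (wellFounded_lt (α := ι)).fix Φ
  have hg : ∀ i, g i = Φ i (fun j _ => g j) := fun i => WellFounded.fix_eq _ _ _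
  refine ⟨g, fun i n => ?_, fun j i hji => ?_⟩
  · rw [hg]
    exact le_max_left _ _
  · rw [evLE_iff]
    rcases hji.eq_or_lt with rfl | hlt
    · exact Filter.Eventually.of_forall fun n => le_rfl
    · have h := evLE_iff.1 (hb (fun j => if h : j < i then g j else 0) i j hlt)
      filter_upwards [h] with n hn
      rw [hg i]
      simp only [hlt, dif_pos] at hn
      exact hn.trans (le_max_right _ _)

/-- In a nonempty second countable space, open covers contain sequences that cover. -/
lemma exists_countable_subcovers {X : Type*} [TopologicalSpace X] [SecondCountableTopology X]
    [Nonempty X] {u : ℕ → Set (Set X)} (hu : ∀ n, IsOpenCover (u n)) :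
    ∃ U : ℕ → ℕ → Set X, (∀ n k, U n k ∈ u n) ∧ ∀ n x, ∃ k, x ∈ U n k := by
  have key : ∀ n, ∃ V : ℕ → Set X, (∀ k, V k ∈ u n) ∧ ∀ x, ∃ k, x ∈ V k := by
    intro n
    obtain ⟨T, hTc, hTu, hT⟩ := TopologicalSpace.isOpen_sUnion_countable (u n) (hu n).1
    rw [(hu n).2] at hT
    have hne : T.Nonempty := by
      obtain ⟨t, ht, -⟩ := (hT ▸ Set.mem_univ (Classical.arbitrary X) :
        Classical.arbitrary X ∈ ⋃₀ T)
      exact ⟨t, ht⟩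
    obtain ⟨V, rfl⟩ := hTc.exists_eq_range hne
    refine ⟨V, fun k => hTu ⟨k, rfl⟩, fun x => ?_⟩
    obtain ⟨_, ⟨k, rfl⟩, hk⟩ := (hT ▸ Set.mem_univ x : x ∈ ⋃₀ Set.range V)
    exact ⟨k, hk⟩
  choose U hU using key
  exact ⟨U, fun n => (hU n).1, fun n => (hU n).2⟩

lemma not_ufinGamma_of_unbounded {Y : Set (ℕ → ℕ)} (hY : ¬ ∃ b, ∀ y ∈ Y, evLE y b) :
    ¬ UfinGamma Y := by
  intro hG
  let W : ℕ → ℕ → Set Y := fun n k => {y | y.1 n ≤ k}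
  obtain ⟨v, hv, hγ⟩ := hG (fun n => Set.range (W n)) fun n => by
    refine ⟨?_, ?_⟩
    · rintro _ ⟨k, rfl⟩
      have hc : Continuous fun y : Y => y.1 n := (continuous_apply n).comp continuous_subtype_val
      exact (isOpen_discrete (Set.Iic k)).preimage hc
    · refine Set.eq_univ_of_forall fun y => ?_
      exact ⟨W n (y.1 n), ⟨_, rfl⟩, le_refl (y.1 n)⟩
  have hb : ∀ n, ∃ b, ∀ y ∈ ⋃₀ v n, y.1 n ≤ b := by
    intro n
    have hk : ∀ w, ∃ k, w ∈ v n → ∀ y ∈ w, y.1 n ≤ k := by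
      intro w
      by_cases hw : w ∈ v n
      · obtain ⟨k, rfl⟩ := (hv n).2 hw
        exact ⟨k, fun _ y hy => hy⟩
      · exact ⟨0, fun h => absurd h hw⟩
    choose k hk using hk
    refine ⟨(hv n).1.toFinset.sup k, ?_⟩
    rintro y ⟨w, hw, hyw⟩
    exact (hk w hw y hyw).trans (Finset.le_sup (f := k) ((hv n).1.mem_toFinset.2 hw))
  choose b hb using hb
  refine hY ⟨b, fun y hy => (hγ ⟨y, hy⟩).subset ?_⟩
  intro n hn hmem
  exact absurd (hb n ⟨y, hy⟩ hmem) (not_le.2 hn)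

/-- If all families indexed by `ι` fail to dominate, the range of any family indexed by `ι`
has the property `Ufin(O,T*)`. -/
lemma ufinTauAst_range {ι : Type*} [LinearOrder ι] [WellFoundedLT ι] [Nonempty ι]
    (hb : ∀ (f : ι → ℕ → ℕ) (i : ι), ∃ b, ∀ j < i, evLE (f j) b)
    (hd : ¬ ∃ d : ι → ℕ → ℕ, ∀ h, ∃ i, evLE h (d i)) (f : ι → ℕ → ℕ) :
    UfinTauAst (Set.range f) := by
  intro u hu
  obtain ⟨U, hUu, hU⟩ := exists_countable_subcovers hu
  choose z hz using hU
  obtain ⟨g, hfg, hg⟩ := exists_evLE_increasing hb (fun i n => z n ⟨f i, i, rfl⟩)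
  have hh : ∃ h : ℕ → ℕ, ∀ i, ¬ evLE h (g i) := by
    by_contra! hcon
    exact hd ⟨g, hcon⟩
  obtain ⟨h, hh⟩ := hh
  refine ⟨fun n => U n '' Set.Iic (h n), fun n => ⟨(Set.finite_Iic _).image _, ?_⟩,
    Set.range fun i => {n | g i n < h n}, ?_, ?_, ?_⟩
  · rintro _ ⟨k, -, rfl⟩
    exact hUu n k
  · rintro _ ⟨i, rfl⟩
    exact hh i
  · have key : ∀ i j, i ≤ j → AlmostSub {n | g j n < h n} {n | g i n < h n} := by
      intro i j hij
      refine (hg i j hij).subset ?_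
      rintro n ⟨h1, h2⟩
      simp only [Set.mem_ofPred_eq, not_lt] at h1 h2 ⊢
      omega
    rintro _ ⟨i, rfl⟩ _ ⟨j, rfl⟩
    rcases le_total i j with hij | hij
    · exact Or.inr (key i j hij)
    · exact Or.inl (key j i hij)
  · rintro ⟨_, i, rfl⟩
    refine ⟨_, ⟨i, rfl⟩, fun n hn => ?_⟩
    exact ⟨_, ⟨z n ⟨f i, i, rfl⟩, (hfg i n).trans hn.le, rfl⟩, hz n _⟩

/-- The points `m` such that `A` misses an interval `[p, g m)` with `g p ≤ m`. -/
def gapPoints (g : ℕ → ℕ) (A : Set ℕ) : Set ℕ :=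
  {m | ∃ p, g p ≤ m ∧ ∀ a ∈ A, ¬ (p ≤ a ∧ a < g m)}

lemma exists_infinite_gapPoints {F : Set (Set ℕ)} (hF : ¬ MeagerFam F) {g : ℕ → ℕ}
    (hg : ∀ n, n < g n) : ∃ A ∈ F, (gapPoints g A).Infinite := by
  by_contra! hcon
  apply hF
  let G : ℕ → Set (ℕ → Bool) := fun N =>
    ⋃ p ∈ Set.Ici N, {f | ∀ a ∈ Set.Ico p (g (g p)), f a = false}
  have hopen : ∀ N, IsOpen (G N) := by
    intro N
    refine isOpen_biUnion fun p _ => ?_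
    have : {f : ℕ → Bool | ∀ a ∈ Set.Ico p (g (g p)), f a = false} =
        (Set.Ico p (g (g p))).pi fun _ => {false} := by
      ext f
      simp [Set.mem_pi]
    rw [this]
    exact isOpen_set_pi (Set.finite_Ico _ _) fun _ _ => isOpen_discrete _
  have hdense : ∀ N, Dense (G N) := by
    intro N
    rw [dense_iff_inter_open]
    rintro V hV ⟨f, hf⟩
    obtain ⟨I, w, hw, hI⟩ := isOpen_pi_iff.1 hV f hf
    let p := max N (I.sup id + 1)
    refine ⟨fun a => if a < p then f a else false, hI fun a ha => ?_, ?_⟩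
    · have hap : a < p :=
        lt_of_lt_of_le (Nat.lt_succ_of_le (Finset.le_sup (f := id) ha)) (le_max_right _ _)
      simpa [hap] using (hw a ha).2
    · refine Set.mem_biUnion (Set.mem_Ici.2 (le_max_left _ _ : N ≤ p)) ?_
      intro a ha
      exact if_neg (not_lt.2 ha.1)
  have hres : (⋂ N, G N) ∈ residual (ℕ → Bool) :=
    countable_iInter_mem.2 fun N => residual_of_dense_open (hopen N) (hdense N)
  refine Filter.mem_of_superset hres fun f hf hfF => ?_
  refine Set.not_infinite.2 (hcon _ hfF) ?_
  refine Set.infinite_of_forall_exists_gt fun N => ?_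
  obtain ⟨p, hpN, hp⟩ := Set.mem_iUnion₂.1 (Set.mem_iInter.1 hf N)
  refine ⟨g p, ⟨p, le_rfl, fun a ha hap => ?_⟩, lt_of_le_of_lt hpN (hg p)⟩
  have h1 : f a = true := ha
  rw [hp a hap] at h1
  exact Bool.false_ne_true h1

/-- The functions supported on `[0, n)` with values at most `n`. -/
def boxFunctions (n : ℕ) : Set (ℕ → ℕ) := {q | (∀ m, q m ≤ n) ∧ ∀ m, n ≤ m → q m = 0}

lemma finite_boxFunctions (n : ℕ) : (boxFunctions n).Finite := by
  have hfin : (Set.univ.pi fun _ : Fin n => Set.Iic n).Finite :=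
    Set.Finite.pi fun _ => Set.finite_Iic n
  refine Set.Finite.of_finite_image (f := fun q (i : Fin n) => q i) (hfin.subset ?_) ?_
  · rintro _ ⟨q, hq, rfl⟩ i -
    exact hq.1 i
  · intro q hq r hr hqr
    funext m
    rcases lt_or_ge m n with hm | hm
    · exact congrFun hqr ⟨m, hm⟩
    · rw [hq.2 m hm, hr.2 m hm]

/-- For an open cover of a space of functions containing the `n`-th box, a finite subfamily
contains everything sufficiently close to the box. -/
lemma exists_finite_cover_box {Y : Set (ℕ → ℕ)} {u : Set (Set Y)} (hu : IsOpenCover u) {n : ℕ}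
    (hn : boxFunctions n ⊆ Y) :
    ∃ v : Set (Set Y), v.Finite ∧ v ⊆ u ∧ ∃ e : ℕ, ∀ q ∈ boxFunctions n, ∀ y : Y,
      (∀ m < e, y.1 m = q m) → y ∈ ⋃₀ v := by
  have key : ∀ q : ℕ → ℕ, ∃ w : Set Y, ∃ e : ℕ, q ∈ boxFunctions n →
      w ∈ u ∧ ∀ y : Y, (∀ m < e, y.1 m = q m) → y ∈ w := by
    intro q
    by_cases hq : q ∈ boxFunctions n
    swap
    · exact ⟨∅, 0, fun h => absurd h hq⟩
    obtain ⟨w, hw, hqw⟩ := (hu.2 ▸ Set.mem_univ (⟨q, hn hq⟩ : Y) : (⟨q, hn hq⟩ : Y) ∈ ⋃₀ u)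
    obtain ⟨V, hV, rfl⟩ := isOpen_induced_iff.1 (hu.1 w hw)
    obtain ⟨I, s, hs, hI⟩ := isOpen_pi_iff.1 hV q hqw
    refine ⟨_, I.sup id + 1, fun _ => ⟨hw, fun y hy => hI fun a ha => ?_⟩⟩
    rw [hy a (Nat.lt_succ_of_le (Finset.le_sup (f := id) ha))]
    exact (hs a ha).2
  choose w e hwe using key
  refine ⟨w '' boxFunctions n, (finite_boxFunctions n).image _, ?_,
    (finite_boxFunctions n).toFinset.sup e, fun q hq y hy => ?_⟩
  · rintro _ ⟨q, hq, rfl⟩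
    exact (hwe q hq).1
  · refine ⟨w q, ⟨q, hq, rfl⟩, (hwe q hq).2 y fun m hm => hy m (hm.trans_le ?_)⟩
    exact Finset.le_sup (f := e) ((finite_boxFunctions n).mem_toFinset.2 hq)

open Classical in
/-- The function equal to `g` at the gap points of `A` and vanishing elsewhere. -/
noncomputable def gapFunction (g : ℕ → ℕ) (A : Set ℕ) (m : ℕ) : ℕ :=
  if m ∈ gapPoints g A then g m else 0

lemma gapFunction_le {g : ℕ → ℕ} {A : Set ℕ} (hg : ∀ n, n < g n) {m n : ℕ} (hn : n ∈ A)
    (hmn : m < n) : gapFunction g A m ≤ n := by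
  unfold gapFunction
  split_ifs with hm
  · obtain ⟨p, hp, hA⟩ := hm
    by_contra! hlt
    exact hA n hn ⟨((hg p).le.trans hp).trans hmn.le, hlt⟩
  · exact Nat.zero_le n

lemma gapFunction_eq_zero {g : ℕ → ℕ} {A : Set ℕ} (hg : ∀ n, n < g n) (hmono : Monotone g)
    {m n : ℕ} (hn : n ∈ A) (hnm : n ≤ m) (hm : m < g n) : gapFunction g A m = 0 := by
  refine if_neg ?_
  rintro ⟨p, hp, hA⟩
  refine hA n hn ⟨?_, hnm.trans_lt (hg m)⟩
  by_contra! hlt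
  exact absurd (hmono hlt.le) (not_le.2 (hp.trans_lt hm))

lemma isTauAstCover_of_mem {X : Type*} {F : Set (Set ℕ)} (hF : IsSimplePFilter F)
    {w : ℕ → Set X} (hw : ∀ x, mu w x ∈ F) : IsTauAstCover w := by
  obtain ⟨-, hinf, B, hBF, hFB, hB⟩ := hF
  have htrans : ∀ {P Q R : Set ℕ}, AlmostSub P Q → AlmostSub Q R → AlmostSub P R := by
    intro P Q R h1 h2
    refine (h1.union h2).subset fun n hn => ?_
    by_cases hq : n ∈ Q
    · exact Or.inr ⟨hq, hn.2⟩
    · exact Or.inl ⟨hn.1, hq⟩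
  refine ⟨{A | ∃ b ∈ B, AlmostSub A b ∧ AlmostSub b A}, ?_, ?_, fun x => ?_⟩
  · rintro A ⟨b, hb, -, hbA⟩
    refine hinf A ?_
    rw [hFB]
    exact ⟨b, hb, hbA⟩
  · rintro A ⟨a, ha, hAa, haA⟩ A' ⟨a', ha', hAa', haA'⟩
    rcases hB a ha a' ha' with h | h
    · exact Or.inl (htrans (htrans hAa h) haA')
    · exact Or.inr (htrans (htrans hAa' h) haA)
  · have hx := hw x
    rw [hFB] at hx
    obtain ⟨b, hb, hbx⟩ := hx
    refine ⟨b ∩ mu w x, ⟨b, hb, ?_, ?_⟩, Set.inter_subset_right⟩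
    · simp [AlmostSub, Set.sdiff_eq_empty.2 Set.inter_subset_left]
    · simpa [AlmostSub] using hbx

/-- A space made of the boxes and the gap functions of a scale, with gaps of members of a
simple P-filter, has the property `Ufin(O,T*)`. -/
lemma ufinTauAst_gapFunctions {ι : Type*} [LinearOrder ι] {F : Set (Set ℕ)}
    (hF : IsSimplePFilter F) (hb : ∀ (f : ι → ℕ → ℕ) (i : ι), ∃ b, ∀ j < i, evLE (f j) b)
    {g : ι → ℕ → ℕ} (hlt : ∀ i n, n < g i n) (hmono : ∀ i, Monotone (g i))
    (hdom : ∀ h, ∃ i, ∀ j, i ≤ j → evLE h (g j)) {A : ι → Set ℕ} (hA : ∀ i, A i ∈ F) :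
    UfinTauAst ↥((⋃ n, boxFunctions n) ∪ Set.range fun i => gapFunction (g i) (A i)) := by
  set Y := (⋃ n, boxFunctions n) ∪ Set.range fun i => gapFunction (g i) (A i)
  have hbox : ∀ n, boxFunctions n ⊆ Y := fun n =>
    (Set.subset_iUnion boxFunctions n).trans Set.subset_union_left
  intro u hu
  choose v hvfin hvu e he using fun n => exists_finite_cover_box (hu n) (hbox n)
  obtain ⟨i₀, hi₀⟩ := hdom e
  have : Nonempty Y := ⟨⟨fun _ => 0, hbox 0 ⟨fun _ => le_rfl, fun _ _ => rfl⟩⟩⟩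
  obtain ⟨U, hUu, hU⟩ := exists_countable_subcovers hu
  choose z hz using hU
  obtain ⟨b, hb⟩ := hb (fun i n => z n ⟨gapFunction (g i) (A i), Or.inr ⟨i, rfl⟩⟩) i₀
  refine ⟨fun n => v n ∪ U n '' Set.Iic (b n), fun n =>
    ⟨(hvfin n).union ((Set.finite_Iic _).image _), Set.union_subset (hvu n) ?_⟩,
    isTauAstCover_of_mem hF ?_⟩
  · rintro _ ⟨k, -, rfl⟩
    exact hUu n k
  have hsemi := hF.1.1.2
  rintro ⟨y, hy | ⟨i, rfl⟩⟩
  · obtain ⟨N, hN⟩ := Set.mem_iUnion.1 hy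
    obtain ⟨i⟩ : Nonempty ι := ⟨i₀⟩
    refine hsemi _ (hA i) _ ((Set.finite_Iio N).subset ?_)
    rintro n ⟨-, hn⟩
    by_contra hle
    refine hn (Set.sUnion_mono Set.subset_union_left (he n y ⟨fun m => ?_, fun m hm => ?_⟩ _
      fun m _ => rfl))
    · exact (hN.1 m).trans (not_lt.1 hle)
    · exact hN.2 m ((not_lt.1 hle).trans hm)
  · refine hsemi _ (hA i) _ ?_
    rcases lt_or_ge i i₀ with hi | hi
    · refine (hb i hi).subset ?_
      rintro n ⟨-, hn⟩
      by_contra hle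
      exact hn ⟨_, Or.inr ⟨_, Set.mem_Iic.2 (not_lt.1 hle), rfl⟩, hz n _⟩
    · refine (hi₀ i hi).subset ?_
      rintro n ⟨hnA, hn⟩
      by_contra hle
      refine hn (Set.sUnion_mono Set.subset_union_left
        (he n (fun m => if m < n then gapFunction (g i) (A i) m else 0)
          ⟨fun m => ?_, fun m hm => if_neg (not_lt.2 hm)⟩ _ fun m hm => ?_))
      · dsimp only
        split_ifs with hmn
        · exact gapFunction_le (hlt i) hnA hmn
        · exact Nat.zero_le n
      · dsimp only
        split_ifs with hmn
        · rfl
        · exact gapFunction_eq_zero (hlt i) (hmono i) hnA (not_lt.1 hmn)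
            (hm.trans_le (not_lt.1 hle))

/-- If initial segments of `ι` are bounded and some family indexed by `ι` dominates, there is a
scale of monotone inflationary functions indexed by `ι`. -/
lemma exists_scale {ι : Type*} [LinearOrder ι]
    (hb : ∀ (f : ι → ℕ → ℕ) (i : ι), ∃ b, ∀ j < i, evLE (f j) b)
    (hd : ∃ d : ι → ℕ → ℕ, ∀ h, ∃ i, evLE h (d i)) :
    ∃ g : ι → ℕ → ℕ, (∀ i n, n < g i n) ∧ (∀ i, Monotone (g i)) ∧
      ∀ h, ∃ i, ∀ j, i ≤ j → evLE h (g j) := by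
  obtain ⟨d, hd⟩ := hd
  choose b hb using hb d
  let g : ι → ℕ → ℕ := fun i n => n + 1 + ∑ k ∈ Finset.range (n + 1), (b i k + d i k)
  have hle : ∀ i n, b i n + d i n ≤ g i n := fun i n =>
    (Finset.single_le_sum (f := fun k => b i k + d i k) (fun _ _ => Nat.zero_le _)
      (Finset.self_mem_range_succ n)).trans (Nat.le_add_left _ _)
  refine ⟨g, fun i n => by simp only [g]; omega, fun i m n hmn => ?_, fun h => ?_⟩
  · exact add_le_add (by omega) (Finset.sum_le_sum_of_subset (Finset.range_mono (by omega)))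
  · obtain ⟨i, hi⟩ := hd h
    refine ⟨i, fun j hij => ?_⟩
    have hdj : ∀ᶠ n in Filter.cofinite, d i n ≤ g j n := by
      rcases hij.eq_or_lt with rfl | hlt
      · exact Filter.Eventually.of_forall fun n => (Nat.le_add_left _ _).trans (hle i n)
      · filter_upwards [evLE_iff.1 (hb j i hlt)] with n hn
        exact hn.trans ((Nat.le_add_right _ _).trans (hle j n))
    rw [evLE_iff] at hi ⊢
    filter_upwards [hi, hdj] with n h1 h2 using h1.trans h2

/-- If there is a nonmeager simple P-filter, then some subspace of the Baire
space has `Ufin(O,T*)` but fails the Hurewicz property `Ufin(O,Γ)`. -/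
theorem stmt_3 (h : ∃ F : Set (Set ℕ), IsSimplePFilter F ∧ ¬ MeagerFam F) :
    ∃ Y : Set (ℕ → ℕ), UfinTauAst Y ∧ ¬ UfinGamma Y := by
  obtain ⟨F, hF, hnm⟩ := h
  obtain ⟨ι, _, _, hb, f, hf⟩ := exists_unbounded_wellOrder
  by_cases hd : ∃ d : ι → ℕ → ℕ, ∀ h, ∃ i, evLE h (d i)
  · obtain ⟨g, hlt, hmono, hdom⟩ := exists_scale hb hd
    choose A hA hinf using fun i => exists_infinite_gapPoints hnm (hlt i)
    refine ⟨_, ufinTauAst_gapFunctions hF hb hlt hmono hdom hA,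
      not_ufinGamma_of_unbounded ?_⟩
    rintro ⟨b, hbd⟩
    obtain ⟨i, hi⟩ := hdom fun n => b n + 1
    refine hinf i (((hi i le_rfl).union (hbd _ (Or.inr ⟨i, rfl⟩))).subset fun m hm => ?_)
    simp only [Set.mem_union, Set.mem_ofPred_eq, gapFunction, if_pos hm]
    omega
  · have : Nonempty ι := by
      by_contra hemp
      rw [not_nonempty_iff] at hemp
      exact hf ⟨0, fun i => hemp.elim i⟩
    refine ⟨Set.range f, ufinTauAst_range hb hd f, not_ufinGamma_of_unbounded ?_⟩
    rintro ⟨b, hbd⟩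
    exact hf ⟨b, fun i => hbd _ ⟨i, rfl⟩⟩
end

section
/- The selection principles Ufin(𝒪,Γ) and Ufin(𝒪,T*) coincide (i.e., every topological space with Ufin(𝒪,T*) has Ufin(𝒪,Γ)) if and only if every semifilter generated by a tower, i.e. every family ↑{T_α : α < λ} for a tower (T_α)_{α<λ}, is meager. -/
open Set Cardinal

universe u

open Filter

theorem almostSub_iff_eventually {A B : Set ℕ} :
    AlmostSub A B ↔ ∀ᶠ n in atTop, n ∈ A → n ∈ B := by
  rw [← Nat.cofinite_eq_atTop, eventually_cofinite, AlmostSub]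
  congr! 1
  ext n
  simp

theorem evLE_iff_eventually {x y : ℕ → ℕ} : evLE x y ↔ ∀ᶠ n in atTop, x n ≤ y n := by
  rw [← Nat.cofinite_eq_atTop, eventually_cofinite, evLE]
  simp only [not_le]

theorem AlmostSub.refl (A : Set ℕ) : AlmostSub A A := by simp [AlmostSub]

theorem AlmostSub.trans {A B C : Set ℕ} (h₁ : AlmostSub A B) (h₂ : AlmostSub B C) :
    AlmostSub A C := by
  rw [almostSub_iff_eventually] at *
  filter_upwards [h₁, h₂] with n h₁ h₂ h using h₂ (h₁ h)

theorem AlmostSub.mono_right {A B C : Set ℕ} (h : AlmostSub A B) (hBC : B ⊆ C) :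
    AlmostSub A C :=
  h.subset (sdiff_subset_sdiff_right hBC)

theorem evLE.trans {x y z : ℕ → ℕ} (h₁ : evLE x y) (h₂ : evLE y z) : evLE x z := by
  rw [evLE_iff_eventually] at *
  filter_upwards [h₁, h₂] with n h₁ h₂ using h₁.trans h₂

theorem not_evLE_iff_frequently {x y : ℕ → ℕ} :
    ¬ evLE x y ↔ ∃ᶠ n in atTop, y n < x n := by
  rw [evLE_iff_eventually, not_eventually]
  simp only [not_le]

/-- Almost inclusion passes to all sufficiently late intervals. -/
theorem AlmostSub.eventually_inter_Ico {A B : Set ℕ} (h : AlmostSub A B) :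
    ∀ᶠ n in atTop, ∀ m, A ∩ Ico n m ⊆ B ∩ Ico n m := by
  filter_upwards [eventually_forall_ge_atTop.2 (almostSub_iff_eventually.1 h)] with n hn m p hp
  exact ⟨hn p hp.2.1 hp.1, hp.2⟩

/-- `g` bounds the gaps of all members of `F`: each of them meets almost all of the
intervals `[n, g n)`. -/
def GapBound (g : ℕ → ℕ) (F : Set (Set ℕ)) : Prop :=
  ∀ A ∈ F, ∀ᶠ n in atTop, (A ∩ Ico n (g n)).Nonempty

theorem GapBound.upCl {g : ℕ → ℕ} {F : Set (Set ℕ)} (h : GapBound g F) :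
    GapBound g (upCl F) := by
  rintro B ⟨A, hA, hAB⟩
  filter_upwards [h A hA, hAB.eventually_inter_Ico] with n h₁ h₂ using h₁.mono (h₂ _)

theorem subset_upCl (F : Set (Set ℕ)) : F ⊆ upCl F := fun A hA => ⟨A, hA, AlmostSub.refl A⟩

theorem exists_forall_agree_mem_of_isOpen {U : Set (ℕ → Bool)} (hU : IsOpen U) {f : ℕ → Bool}
    (hf : f ∈ U) : ∃ N, ∀ f', (∀ i < N, f' i = f i) → f' ∈ U := by
  obtain ⟨I, u, hu, hIU⟩ := isOpen_pi_iff.1 hU f hf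
  refine ⟨I.sup id + 1, fun f' hf' => hIU fun i hi => ?_⟩
  rw [hf' i (Nat.lt_succ_of_le (Finset.le_sup (f := id) hi))]
  exact (hu i hi).2

theorem GapBound.meagerFam {g : ℕ → ℕ} {F : Set (Set ℕ)} (h : GapBound g F) : MeagerFam F := by
  let C : ℕ → Set (ℕ → Bool) := fun m => {f | ∀ n ≥ m, ∃ p ∈ Finset.Ico n (g n), f p = true}
  have hC : ∀ m, IsClosed (C m) := by
    intro m
    have : C m = ⋂ n ≥ m, ⋃ p ∈ Finset.Ico n (g n), (fun f : ℕ → Bool => f p) ⁻¹' {true} := by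
      ext f
      simp [C]
    rw [this]
    refine isClosed_iInter fun n => isClosed_iInter fun _ => ?_
    exact (Finset.Ico n (g n)).finite_toSet.isClosed_biUnion fun p _ =>
      (isClosed_discrete _).preimage (continuous_apply p)
  have hC' : ∀ m, IsMeagre (C m) := by
    intro m
    refine IsNowhereDense.isMeagre ((hC m).isNowhereDense_iff.2 ?_)
    rw [eq_empty_iff_forall_notMem]
    intro f hf
    obtain ⟨N, hN⟩ := exists_forall_agree_mem_of_isOpen isOpen_interior hf
    have h₁ := interior_subset (hN (fun i => if i < N then f i else false)
      (fun i hi => by simp [hi]))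
    obtain ⟨p, hp, hp'⟩ := h₁ (max m N) (le_max_left _ _)
    simp only [Finset.mem_Ico] at hp
    have : ¬ p < N := by omega
    simp [this] at hp'
  refine (isMeagre_iUnion hC').mono fun f hf => ?_
  obtain ⟨m, hm⟩ := eventually_atTop.1 (h _ hf)
  refine mem_iUnion.2 ⟨m, fun n hn => ?_⟩
  obtain ⟨p, hp, hp'⟩ := hm n hn
  exact ⟨p, by simpa using hp', hp⟩

/-- A dense open subset of the Cantor space is entered by prescribing the values on a suitable
finite interval starting at `n`, regardless of the values before `n`. -/
theorem exists_pattern_of_isOpen_dense {O : Set (ℕ → Bool)} (hO : IsOpen O) (hd : Dense O)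
    (n : ℕ) : ∃ m, n < m ∧ ∃ s : ℕ → Bool, ∀ x, (∀ p ∈ Ico n m, x p = s p) → x ∈ O := by
  suffices H : ∀ L : Finset (Fin n → Bool), ∃ m, n < m ∧ ∃ s : ℕ → Bool, ∀ x : ℕ → Bool,
      (fun i : Fin n => x i) ∈ L → (∀ p ∈ Ico n m, x p = s p) → x ∈ O by
    obtain ⟨m, hm, s, hs⟩ := H Finset.univ
    exact ⟨m, hm, s, fun x hx => hs x (Finset.mem_univ _) hx⟩
  intro L
  induction L using Finset.induction_on with
  | empty => exact ⟨n + 1, n.lt_succ_self, fun _ => false, by simp⟩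
  | insert t L _ ih =>
    obtain ⟨m, hm, s, hs⟩ := ih
    let y : ℕ → Bool := fun i => if h : i < n then t ⟨i, h⟩ else s i
    let V : Set (ℕ → Bool) := ⋂ i ∈ Finset.range m, (fun f : ℕ → Bool => f i) ⁻¹' {y i}
    have hV : IsOpen V := isOpen_biInter_finset fun i _ =>
      (isOpen_discrete _).preimage (continuous_apply i)
    obtain ⟨z, hzV, hzO⟩ := hd.inter_open_nonempty V hV ⟨y, by simp [V]⟩
    have hzy : ∀ i < m, z i = y i := by simpa [V] using hzV
    obtain ⟨N, hN⟩ := exists_forall_agree_mem_of_isOpen hO hzO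
    refine ⟨max m N, by omega, z, fun x hxL hx => ?_⟩
    rcases Finset.mem_insert.1 hxL with h | h
    · refine hN x fun i hi => ?_
      by_cases hin : i < n
      · rw [hzy i (hin.trans hm)]
        simp only [y, hin, dif_pos]
        exact congrFun h ⟨i, hin⟩
      · exact hx i ⟨not_lt.1 hin, lt_max_of_lt_right hi⟩
    · refine hs x h fun p hp => ?_
      rw [hx p ⟨hp.1, lt_max_of_lt_left hp.2⟩, hzy p hp.2]
      simp [y, not_lt.2 hp.1]

theorem exists_antitone_isOpen_dense_of_isMeagre {M : Set (ℕ → Bool)} (hM : IsMeagre M) :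
    ∃ O : ℕ → Set (ℕ → Bool), (∀ i, IsOpen (O i)) ∧ (∀ i, Dense (O i)) ∧ Antitone O ∧
      ∀ x ∈ M, ∃ i, x ∉ O i := by
  obtain ⟨S, hSo, hSd, hSc, hS⟩ := mem_residual_iff.1 hM
  obtain ⟨W, hW⟩ := (hSc.insert Set.univ).exists_eq_range (insert_nonempty _ _)
  have hWmem : ∀ i, W i = Set.univ ∨ W i ∈ S := fun i => by
    have : W i ∈ insert Set.univ S := hW ▸ mem_range_self i
    simpa using this
  have hWo : ∀ i, IsOpen (W i) := fun i => by
    rcases hWmem i with h | h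
    · simp [h]
    · exact hSo _ h
  have hWd : ∀ i, Dense (W i) := fun i => by
    rcases hWmem i with h | h
    · simp [h]
    · exact hSd _ h
  have hsucc : ∀ i, (⋂ j ∈ Finset.range (i + 1), W j) = W i ∩ ⋂ j ∈ Finset.range i, W j := by
    intro i
    rw [Finset.range_add_one, Finset.set_biInter_insert]
  have hopen : ∀ i, IsOpen (⋂ j ∈ Finset.range i, W j) := fun i =>
    isOpen_biInter_finset fun j _ => hWo j
  refine ⟨fun i => ⋂ j ∈ Finset.range i, W j, hopen, fun i => ?_, ?_, fun x hx => ?_⟩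
  · induction i with
    | zero => simp
    | succ i ih =>
      simp only [hsucc]
      exact (hWd i).inter_of_isOpen_left ih (hWo i)
  · exact antitone_nat_of_succ_le fun i => by
      simp only [hsucc]
      exact inter_subset_right
  · by_contra! hcon
    refine hS (fun s hs => ?_) hx
    obtain ⟨i, rfl⟩ : s ∈ range W := hW ▸ mem_insert_of_mem _ hs
    have := hcon (i + 1)
    rw [hsucc] at this
    exact this.1

theorem MeagerFam.exists_gapBound {F : Set (Set ℕ)} (hF : MeagerFam F)
    (hmono : ∀ A ∈ F, ∀ B, A ⊆ B → B ∈ F) : ∃ g, GapBound g F := by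
  classical
  obtain ⟨O, hOo, hOd, hOa, hO⟩ := exists_antitone_isOpen_dense_of_isMeagre hF
  choose G hG s hs using fun n => exists_pattern_of_isOpen_dense (hOo n) (hOd n) n
  let k : ℕ → ℕ := fun n => G^[n] 0
  have hk : ∀ n, k (n + 1) = G (k n) := fun n => Function.iterate_succ_apply' G n 0
  have hkm : StrictMono k := strictMono_nat_of_lt_succ fun n => by rw [hk]; exact hG _
  refine ⟨fun n => k (n + 1), fun A hA => ?_⟩
  suffices H : ∀ᶠ n in atTop, (A ∩ Ico (k n) (k (n + 1))).Nonempty by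
    filter_upwards [H] with n hn
    exact hn.mono (inter_subset_inter_right _ (Ico_subset_Ico_left (hkm.id_le n)))
  by_contra hcon
  rw [not_eventually] at hcon
  let x : ℕ → Bool := fun p => decide (p ∈ A ∨
    ∃ n, A ∩ Ico (k n) (k (n + 1)) = ∅ ∧ p ∈ Ico (k n) (k (n + 1)) ∧ s (k n) p = true)
  have hx : {n | x n = true} ∈ F := hmono A hA _ fun p hp => by simp [x, hp]
  obtain ⟨i, hi⟩ := hO x hx
  obtain ⟨n, hn, hne⟩ := frequently_atTop.1 hcon i
  rw [not_nonempty_iff_eq_empty] at hne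
  refine hi (hOa (hn.trans (hkm.id_le n)) (hs (k n) x fun p hp => ?_))
  rw [← hk] at hp
  have hpA : p ∉ A := fun h => (hne ▸ (⟨h, hp⟩ : p ∈ A ∩ Ico (k n) (k (n + 1))) : p ∈ (∅ : Set ℕ))
  rw [Bool.eq_iff_iff]
  simp only [x, decide_eq_true_eq, hpA, false_or]
  constructor
  · rintro ⟨n', -, hp', h⟩
    have h₁ : n < n' + 1 := hkm.lt_iff_lt.1 (hp.1.trans_lt hp'.2)
    have h₂ : n' < n + 1 := hkm.lt_iff_lt.1 (hp'.1.trans_lt hp.2)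
    obtain rfl : n = n' := by omega
    exact h
  · exact fun h => ⟨n, hne, hp, h⟩

theorem meagerFam_upCl_iff {F : Set (Set ℕ)} : MeagerFam (upCl F) ↔ ∃ g, GapBound g F := by
  constructor
  · intro h
    obtain ⟨g, hg⟩ := h.exists_gapBound fun A ⟨C, hC, hCA⟩ B hAB => ⟨C, hC, hCA.mono_right hAB⟩
    exact ⟨g, fun A hA => hg A (subset_upCl F hA)⟩
  · rintro ⟨g, hg⟩
    exact hg.upCl.meagerFam

/-- A family linearly preordered by `⊆*` has a coinitial subfamily that forms a tower. -/
theorem exists_tower_coinitial {J : Set (Set ℕ)} (hinf : ∀ A ∈ J, A.Infinite)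
    (hlin : LinearAlmost J) :
    ∃ (lam : Ordinal.{u}) (T : Ordinal.{u} → Set ℕ), IsTower lam T ∧
      J ⊆ upCl {A | ∃ α < lam, A = T α} := by
  classical
  let J' : Set (Set ℕ) := {A | A ∈ J ∧ ∀ B ∈ J, WellOrderingRel B A → ¬ AlmostSub B A}
  let r : J' → J' → Prop := Subrel WellOrderingRel (· ∈ J')
  let T : Ordinal.{u} → Set ℕ := fun α =>
    if h : ∃ A : J', Ordinal.lift.{u} (Ordinal.typein r A) = α then (h.choose : Set ℕ) else ∅
  have hT : ∀ α < Ordinal.lift.{u} (Ordinal.type r), ∃ A : J',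
      Ordinal.lift.{u} (Ordinal.typein r A) = α ∧ T α = A := by
    intro α hα
    obtain ⟨α', hα', rfl⟩ := Ordinal.lt_lift_iff.1 hα
    have h : ∃ A : J', Ordinal.lift.{u} (Ordinal.typein r A) = Ordinal.lift.{u} α' :=
      ⟨Ordinal.enum r ⟨α', hα'⟩, by rw [Ordinal.typein_enum]⟩
    exact ⟨h.choose, h.choose_spec, dif_pos h⟩
  refine ⟨Ordinal.lift.{u} (Ordinal.type r), T, ⟨fun α hα => ?_, fun β α hβα hα => ?_⟩,
    fun A hA => ?_⟩
  · obtain ⟨A, -, hA⟩ := hT α hα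
    exact hA ▸ hinf _ A.2.1
  · obtain ⟨A, hA, hTA⟩ := hT α hα
    obtain ⟨B, hB, hTB⟩ := hT β (hβα.trans_lt hα)
    rw [hTA, hTB]
    have hle : Ordinal.typein r B ≤ Ordinal.typein r A := by
      rwa [← Ordinal.lift_le.{u}, hA, hB]
    rcases hle.eq_or_lt with h | h
    · rw [(Ordinal.typein_inj r).1 h]
      exact AlmostSub.refl _
    · exact (hlin _ A.2.1 _ B.2.1).resolve_right (A.2.2 _ B.2.1 ((Ordinal.typein_lt_typein r).1 h))
  · have hne : {C | C ∈ J ∧ AlmostSub C A}.Nonempty := ⟨A, hA, AlmostSub.refl A⟩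
    have hwf : WellFounded (WellOrderingRel : Set ℕ → Set ℕ → Prop) := IsWellFounded.wf
    let C := hwf.min _ hne
    have hC : C ∈ J ∧ AlmostSub C A := hwf.min_mem _ hne
    have hCJ' : C ∈ J' := ⟨hC.1, fun B hB hBC hsub =>
      hwf.not_lt_min {C | C ∈ J ∧ AlmostSub C A} (x := B) ⟨hB, hsub.trans hC.2⟩ hBC⟩
    have hlt : Ordinal.lift.{u} (Ordinal.typein r (⟨C, hCJ'⟩ : J')) <
        Ordinal.lift.{u} (Ordinal.type r) :=
      Ordinal.lift_lt.2 (Ordinal.typein_lt_type r _)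
    obtain ⟨D, hD, hTD⟩ := hT _ hlt
    rw [Ordinal.lift_inj, Ordinal.typein_inj] at hD
    exact ⟨C, ⟨_, hlt, by rw [hTD, hD]⟩, hC.2⟩

theorem ufinGamma_of_ufinTauAst {X : Type*} [TopologicalSpace X]
    (hb : ∀ J : Set (Set ℕ), (∀ A ∈ J, A.Infinite) → LinearAlmost J → ∃ g, GapBound g J)
    (hX : UfinTauAst X) : UfinGamma X := by
  classical
  intro u hu
  let w : ℕ → Set (Set X) := fun n => {W | IsOpen W ∧ ∀ i ≤ n, ∃ U ∈ u i, W ⊆ U}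
  have hw : ∀ n, IsOpenCover (w n) := by
    refine fun n => ⟨fun W hW => hW.1, eq_univ_of_forall fun x => ?_⟩
    have hx : ∀ i, ∃ U ∈ u i, x ∈ U := fun i => by
      have : x ∈ ⋃₀ u i := (hu i).2 ▸ mem_univ x
      simpa using this
    choose U hU hxU using hx
    have hxI : x ∈ ⋂ i ∈ Finset.range (n + 1), U i := by simpa using fun i _ => hxU i
    refine mem_sUnion.2 ⟨_, ⟨isOpen_biInter_finset fun i _ => (hu i).1 _ (hU i),
      fun i hi => ⟨U i, hU i, ?_⟩⟩, hxI⟩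
    exact biInter_subset_of_mem (Finset.mem_coe.2 (Finset.mem_range.2 (Nat.lt_succ_of_le hi)))
  obtain ⟨v, hv, J, hJinf, hJlin, hJ⟩ := hX w hw
  obtain ⟨g, hg⟩ := hb J hJinf hJlin
  have hc : ∀ n, ∀ W : Set X, ∃ U, (∃ U ∈ u n, W ⊆ U) → U ∈ u n ∧ W ⊆ U := fun n W => by
    by_cases h : ∃ U ∈ u n, W ⊆ U
    · obtain ⟨U, hU⟩ := h
      exact ⟨U, fun _ => hU⟩
    · exact ⟨∅, fun h' => absurd h' h⟩
  choose c hc using hc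
  have hc' : ∀ n m, n ≤ m → ∀ W ∈ v m, c n W ∈ u n ∧ W ⊆ c n W := fun n m hnm W hW =>
    hc n W (((hv m).2 hW).2 n hnm)
  refine ⟨fun n => ⋃ m ∈ Ico n (g n), c n '' v m, fun n => ⟨?_, ?_⟩, fun x => ?_⟩
  · exact (finite_Ico _ _).biUnion fun m _ => (hv m).1.image _
  · refine iUnion₂_subset fun m hm => ?_
    rintro _ ⟨W, hW, rfl⟩
    exact (hc' n m hm.1 W hW).1
  · obtain ⟨A, hA, hAx⟩ := hJ x
    have hev : ∀ᶠ n in atTop, n ∈ mu (fun n => ⋃₀ ⋃ m ∈ Ico n (g n), c n '' v m) x := by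
      filter_upwards [hg A hA] with n hn
      obtain ⟨m, hmA, hm⟩ := hn
      obtain ⟨W, hW, hxW⟩ := hAx hmA
      exact mem_sUnion.2 ⟨c n W, mem_biUnion hm (mem_image_of_mem (c n) hW),
        (hc' n m hm.1 W hW).2 hxW⟩
    rwa [← Nat.cofinite_eq_atTop] at hev

/-- The semifilter generated by `G`, to be regarded as a topological space. -/
structure SemifilterSpace (G : Set (Set ℕ)) : Type u where
  /-- The underlying subset of `ℕ`. -/
  set : Set ℕ
  mem : set ∈ upCl G

namespace SemifilterSpace

/-- The topology with base `{y | a ⊆ y.set}`, where `a` is finite. -/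
instance (G : Set (Set ℕ)) : TopologicalSpace (SemifilterSpace.{u} G) where
  IsOpen U := ∀ x ∈ U, ∃ a : Finset ℕ, ↑a ⊆ x.set ∧ ∀ y : SemifilterSpace G, ↑a ⊆ y.set → y ∈ U
  isOpen_univ := fun x _ => ⟨∅, by simp, fun _ _ => mem_univ _⟩
  isOpen_inter := by
    classical
    rintro U V hU hV x ⟨hxU, hxV⟩
    obtain ⟨a, ha, haU⟩ := hU x hxU
    obtain ⟨b, hb, hbV⟩ := hV x hxV
    refine ⟨a ∪ b, by simp [ha, hb], fun y hy => ?_⟩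
    rw [Finset.coe_union, union_subset_iff] at hy
    exact ⟨haU y hy.1, hbV y hy.2⟩
  isOpen_sUnion := by
    rintro S hS x ⟨U, hU, hxU⟩
    obtain ⟨a, ha, haU⟩ := hS U hU x hxU
    exact ⟨a, ha, fun y hy => ⟨U, hU, haU y hy⟩⟩

variable {G : Set (Set ℕ)}

/-- Some member of `u` contains all points that include `A`. -/
def Captures (u : Set (Set (SemifilterSpace.{u} G))) (A : Set ℕ) : Prop :=
  ∃ U ∈ u, ∀ y : SemifilterSpace.{u} G, A ⊆ y.set → y ∈ U

theorem Captures.mono {u : Set (Set (SemifilterSpace.{u} G))} {A B : Set ℕ} (h : Captures u A)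
    (hAB : A ⊆ B) : Captures u B := by
  obtain ⟨U, hU, h⟩ := h
  exact ⟨U, hU, fun y hy => h y (hAB.trans hy)⟩

theorem exists_captures_inter_Ico {u : Set (Set (SemifilterSpace.{u} G))} (hu : IsOpenCover u)
    {A : Set ℕ} (hA : A ∈ upCl G) (n : ℕ) : ∃ m, Captures u (A ∩ Ico n m) := by
  obtain ⟨B, hB, hBA⟩ := hA
  have hn : AlmostSub B (A ∩ Ici n) := by
    rw [almostSub_iff_eventually] at *
    filter_upwards [hBA, eventually_ge_atTop n] with k h₁ h₂ h₃ using ⟨h₁ h₃, h₂⟩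
  let x : SemifilterSpace.{u} G := ⟨A ∩ Ici n, B, hB, hn⟩
  obtain ⟨U, hU, hxU⟩ : x ∈ ⋃₀ u := hu.2 ▸ mem_univ x
  obtain ⟨a, ha, haU⟩ := hu.1 U hU x hxU
  refine ⟨a.sup id + 1, U, hU, fun y hy => haU y fun p hp => hy ?_⟩
  exact ⟨(ha hp).1, (ha hp).2, Nat.lt_succ_of_le (Finset.le_sup (f := id) hp)⟩

theorem exists_finite_captures (u : Set (Set (SemifilterSpace.{u} G))) (n m : ℕ) :
    ∃ v : Set (Set (SemifilterSpace.{u} G)), (v.Finite ∧ v ⊆ u) ∧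
      ∀ y : SemifilterSpace.{u} G, Captures u (y.set ∩ Ico n m) → y ∈ ⋃₀ v := by
  classical
  have hc : ∀ A : Set ℕ, ∃ U, Captures u A →
      U ∈ u ∧ ∀ y : SemifilterSpace.{u} G, A ⊆ y.set → y ∈ U := fun A => by
    by_cases h : Captures u A
    · obtain ⟨U, hU⟩ := h
      exact ⟨U, fun _ => hU⟩
    · exact ⟨∅, fun h' => absurd h' h⟩
  choose c hc using hc
  refine ⟨c '' {A | A ⊆ Ico n m ∧ Captures u A}, ⟨?_, ?_⟩, fun y hy => ?_⟩
  · exact ((finite_Ico n m).finite_subsets.subset fun A hA => hA.1).image c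
  · rintro _ ⟨A, hA, rfl⟩
    exact (hc A hA.2).1
  · exact ⟨_, ⟨_, ⟨inter_subset_right, hy⟩, rfl⟩, (hc _ hy).2 y inter_subset_left⟩

theorem ufinTauAst
    (H : ∀ u : ℕ → Set (Set (SemifilterSpace.{u} G)), (∀ n, IsOpenCover (u n)) →
      ∃ (h : ℕ → ℕ) (J : Set (Set ℕ)), (∀ A ∈ J, A.Infinite) ∧ LinearAlmost J ∧
        ∀ B ∈ G, ∃ A ∈ J, ∀ᶠ n in atTop, n ∈ A → Captures (u n) (B ∩ Ico n (h n))) :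
    UfinTauAst (SemifilterSpace.{u} G) := by
  intro u hu
  obtain ⟨h, J, hJinf, hJlin, hJ⟩ := H u hu
  choose v hv hvc using fun n => exists_finite_captures (u n) n (h n)
  have htail : ∀ (A : Set ℕ) (k : ℕ), AlmostSub A (A ∩ Ici k) := fun A k => by
    rw [almostSub_iff_eventually]
    filter_upwards [eventually_ge_atTop k] with n hn hA using ⟨hA, hn⟩
  refine ⟨v, hv, {A' | ∃ A ∈ J, ∃ k, A' = A ∩ Ici k}, ?_, ?_, fun x => ?_⟩
  · rintro _ ⟨A, hA, k, rfl⟩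
    exact Nat.frequently_atTop_iff_infinite.1
      ((Nat.frequently_atTop_iff_infinite.2 (hJinf A hA)).and_eventually (eventually_ge_atTop k))
  · rintro _ ⟨A, hA, k, rfl⟩ _ ⟨B, hB, l, rfl⟩
    refine (hJlin A hA B hB).imp (fun h => ?_) (fun h => ?_)
    · exact (h.trans (htail B l)).subset (sdiff_subset_sdiff_left inter_subset_left)
    · exact (h.trans (htail A k)).subset (sdiff_subset_sdiff_left inter_subset_left)
  · obtain ⟨B, hB, hBx⟩ := x.mem
    obtain ⟨A, hA, hAB⟩ := hJ B hB
    obtain ⟨k, hk⟩ := eventually_atTop.1 (hAB.and hBx.eventually_inter_Ico)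
    exact ⟨_, ⟨A, hA, k, rfl⟩, fun n hn =>
      hvc n x (((hk n hn.2).1 hn.1).mono ((hk n hn.2).2 _))⟩

theorem exists_gapBound_of_ufinGamma (hinf : ∀ A ∈ G, A.Infinite)
    (hG : UfinGamma (SemifilterSpace.{u} G)) : ∃ g, GapBound g G := by
  let u : ℕ → Set (Set (SemifilterSpace.{u} G)) := fun n => {U | ∃ m ≥ n, U = {x | m ∈ x.set}}
  have hu : ∀ n, IsOpenCover (u n) := by
    refine fun n => ⟨?_, eq_univ_of_forall fun x => ?_⟩
    · rintro _ ⟨m, -, rfl⟩ x hx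
      exact ⟨{m}, by simpa using hx, fun y hy => by simpa using hy⟩
    · obtain ⟨A, hA, hAx⟩ := x.mem
      obtain ⟨m, hm⟩ := ((Nat.frequently_atTop_iff_infinite.2 (hinf A hA)).and_eventually
        ((almostSub_iff_eventually.1 hAx).and (eventually_ge_atTop n))).exists
      exact mem_sUnion.2 ⟨_, ⟨m, hm.2.2, rfl⟩, hm.2.1 hm.1⟩
  obtain ⟨v, hv, hγ⟩ := hG u hu
  have hbound : ∀ n, ∃ b, ∀ x ∈ ⋃₀ v n, (x.set ∩ Ico n b).Nonempty := by
    intro n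
    have hb : ∀ U ∈ v n, ∃ m ≥ n, U = {x | m ∈ x.set} := fun U hU => (hv n).2 hU
    choose! c hcn hc using hb
    obtain ⟨b, hb⟩ := ((hv n).1.image c).bddAbove
    refine ⟨b + 1, fun x ⟨U, hU, hxU⟩ => ⟨c U, ?_, hcn U hU, ?_⟩⟩
    · rw [hc U hU] at hxU
      exact hxU
    · exact Nat.lt_succ_of_le (hb (mem_image_of_mem c hU))
  choose g hg using hbound
  refine ⟨g, fun A hA => ?_⟩
  have hx := hγ ⟨A, subset_upCl G hA⟩
  change ∀ᶠ n in cofinite, _ at hx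
  rw [Nat.cofinite_eq_atTop] at hx
  filter_upwards [hx] with n hn using hg n _ hn

/-- If there is no scale, then the space of every linearly preordered family has
`Ufin(O,T*)`. -/
theorem ufinTauAst_of_not_exists_scale (hlin : LinearAlmost G)
    (hscale : ¬ ∃ S : Set (ℕ → ℕ), (∀ a ∈ S, ∀ b ∈ S, evLE a b ∨ evLE b a) ∧
      ∀ x, ∃ y ∈ S, evLE x y) :
    UfinTauAst (SemifilterSpace.{u} G) := by
  classical
  refine ufinTauAst fun u hu => ?_
  have hz : ∀ A ∈ G, ∀ n, ∃ m, Captures (u n) (A ∩ Ico n m) := fun A hA n =>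
    exists_captures_inter_Ico (hu n) (subset_upCl G hA) n
  let z : Set ℕ → ℕ → ℕ := fun A n => sInf {m | Captures (u n) (A ∩ Ico n m)}
  have hzmem : ∀ A ∈ G, ∀ n, Captures (u n) (A ∩ Ico n (z A n)) := fun A hA n =>
    Nat.sInf_mem (hz A hA n)
  have hzmono : ∀ A ∈ G, ∀ B, AlmostSub A B → evLE (z B) (z A) := by
    intro A hA B hAB
    rw [evLE_iff_eventually]
    filter_upwards [hAB.eventually_inter_Ico] with n hn
    exact Nat.sInf_le ((hzmem A hA n).mono (hn _))
  obtain ⟨h, hh⟩ : ∃ h, ∀ A ∈ G, ¬ evLE h (z A) := by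
    by_contra! hcon
    refine hscale ⟨z '' G, ?_, fun x => ?_⟩
    · rintro _ ⟨A, hA, rfl⟩ _ ⟨B, hB, rfl⟩
      exact (hlin A hA B hB).symm.imp (hzmono B hB A) (hzmono A hA B)
    · obtain ⟨A, hA, hxA⟩ := hcon x
      exact ⟨_, mem_image_of_mem z hA, hxA⟩
  let T : Set ℕ → Set ℕ := fun A => {n | Captures (u n) (A ∩ Ico n (h n))}
  have hT : ∀ A B, AlmostSub A B → AlmostSub (T A) (T B) := by
    intro A B hAB
    rw [almostSub_iff_eventually]
    filter_upwards [hAB.eventually_inter_Ico] with n hn hnA using Captures.mono hnA (hn _)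
  refine ⟨h, T '' G, ?_, ?_, fun A hA => ⟨_, mem_image_of_mem T hA, .of_forall fun n hn => hn⟩⟩
  · rintro _ ⟨A, hA, rfl⟩
    rw [← Nat.frequently_atTop_iff_infinite]
    refine (not_evLE_iff_frequently.1 (hh A hA)).mono fun n hn => ?_
    exact (hzmem A hA n).mono (inter_subset_inter_right _ (Ico_subset_Ico_right hn.le))
  · rintro _ ⟨A, hA, rfl⟩ _ ⟨B, hB, rfl⟩
    exact (hlin A hA B hB).imp (hT A B) (hT B A)

end SemifilterSpace

theorem exists_forall_evLE_of_card_lt {S : Set (ℕ → ℕ)} (hS : #S < cardB) :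
    ∃ y, ∀ x ∈ S, evLE x y := by
  by_contra h
  exact notMem_of_lt_csInf' hS ⟨S, rfl, h⟩

theorem exists_unbounded_card_eq_cardB :
    ∃ B : Set (ℕ → ℕ), #B = cardB ∧ ¬ ∃ y, ∀ x ∈ B, evLE x y := by
  obtain ⟨B, hB, hB'⟩ : cardB ∈ {c | ∃ S : Set (ℕ → ℕ), c = #S ∧
      ¬ ∃ y : ℕ → ℕ, ∀ x ∈ S, evLE x y} :=
    csInf_mem ⟨_, Set.univ, rfl, fun ⟨y, hy⟩ => by
      have := evLE_iff_eventually.1 (hy (fun n => y n + 1) (mem_univ _))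
      obtain ⟨n, hn⟩ := this.exists
      omega⟩
  exact ⟨B, hB.symm, hB'⟩

/-- A linearly preordered dominating family can be reindexed by a well-order with bounded initial
segments. -/
theorem exists_scale_indexed {S : Set (ℕ → ℕ)}
    (hlin : ∀ a ∈ S, ∀ b ∈ S, evLE a b ∨ evLE b a) (hdom : ∀ x, ∃ y ∈ S, evLE x y) :
    ∃ (ι : Type) (_ : Nonempty ι) (r : ι → ι → Prop) (_ : IsWellOrder ι r) (d : ι → ℕ → ℕ),
      (∀ g, ∃ i₀, ∀ i, ¬ r i i₀ → evLE g (d i)) ∧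
      ∀ (z : ι → ℕ → ℕ) (i₀ : ι), ∃ y, ∀ i, r i i₀ → evLE (z i) y := by
  obtain ⟨B, hB, hunb⟩ := exists_unbounded_card_eq_cardB
  obtain ⟨r, hr, hord⟩ := Cardinal.exists_ord_eq B
  have hseg : ∀ (z : B → ℕ → ℕ) (i₀ : B), ∃ y, ∀ i, r i i₀ → evLE (z i) y := by
    intro z i₀
    have hcard : #{i // r i i₀} < cardB := by
      rw [← Ordinal.card_typein, ← hB]
      exact Cardinal.card_typein_lt i₀ hord
    obtain ⟨y, hy⟩ := exists_forall_evLE_of_card_lt (S := z '' {i | r i i₀})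
      (Cardinal.mk_image_le.trans_lt hcard)
    exact ⟨y, fun i hi => hy _ (mem_image_of_mem z hi)⟩
  have hd : ∀ i : B, ∃ y ∈ S, ∀ j : B, ¬ r i j → evLE j y := by
    intro i
    obtain ⟨y, hy⟩ := hseg (fun j => j) i
    obtain ⟨s, hs, hys⟩ := hdom (fun n => max (y n) (i.1 n))
    refine ⟨s, hs, fun j hj => ?_⟩
    have hjy : evLE j (fun n => max (y n) (i.1 n)) := by
      rw [evLE_iff_eventually]
      by_cases hji : j = i
      · exact .of_forall fun n => hji ▸ le_max_right _ _
      · have hrji : r j i := (trichotomous_of r j i).resolve_right (by tauto)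
        filter_upwards [evLE_iff_eventually.1 (hy j hrji)] with n hn using le_max_of_le_left hn
    exact hjy.trans hys
  choose d hdS hd using hd
  have hne : Nonempty B := by
    by_contra hempty
    rw [not_nonempty_iff] at hempty
    exact hunb ⟨fun _ => 0, fun x hx => hempty.elim ⟨x, hx⟩⟩
  refine ⟨B, hne, r, hr, d, fun g => ?_, hseg⟩
  obtain ⟨s, hs, hgs⟩ := hdom g
  obtain ⟨b, hb, hbs⟩ : ∃ b ∈ B, ¬ evLE b s := by
    by_contra! hcon
    exact hunb ⟨s, hcon⟩
  refine ⟨⟨b, hb⟩, fun i hi => hgs.trans ?_⟩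
  exact (hlin s hs (d i) (hdS i)).resolve_right fun h => hbs ((hd i ⟨b, hb⟩ hi).trans h)

/-- The union of the intervals `[n, D n)` for `n ∈ A`. -/
def thicken (A : Set ℕ) (D : ℕ → ℕ) : Set ℕ := {p | ∃ n ∈ A, p ∈ Ico n (D n)}

theorem thicken_inter_Ico_eq_empty {A : Set ℕ} {D : ℕ → ℕ} (hD : StrictMono D) {n : ℕ}
    (hA : A ∩ Ico n (D (D n)) = ∅) : thicken A D ∩ Ico (D n) (D (D n)) = ∅ := by
  rw [eq_empty_iff_forall_notMem] at hA ⊢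
  rintro p ⟨⟨m, hm, hmp, hpm⟩, hp⟩
  have hmn : n < m := hD.lt_iff_lt.1 (hp.1.trans_lt hpm)
  exact hA m ⟨hm, hmn.le, hmp.trans_lt hp.2⟩

/-- If there is a scale, then a linearly preordered family that has no gap bound yields another
family without a gap bound, whose space has `Ufin(O,T*)`. -/
theorem exists_thickened_family {J : Set (Set ℕ)} (hinf : ∀ A ∈ J, A.Infinite)
    (hlin : LinearAlmost J) (hgap : ¬ ∃ g, GapBound g J) {S : Set (ℕ → ℕ)}
    (hSlin : ∀ a ∈ S, ∀ b ∈ S, evLE a b ∨ evLE b a) (hdom : ∀ x, ∃ y ∈ S, evLE x y) :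
    ∃ G : Set (Set ℕ), (∀ A ∈ G, A.Infinite) ∧ (¬ ∃ g, GapBound g G) ∧
      UfinTauAst (SemifilterSpace.{u} G) := by
  classical
  obtain ⟨ι, hι, r, hr, d, hd, hseg⟩ := exists_scale_indexed hSlin hdom
  let D : ι → ℕ → ℕ := fun i n => ∑ k ∈ Finset.range (n + 1), (d i k + 1)
  have hDs : ∀ i, StrictMono (D i) := fun i => strictMono_nat_of_lt_succ fun n => by
    simp only [D, Finset.sum_range_succ _ (n + 1)]
    omega
  have hDlt : ∀ i n, n < D i n ∧ d i n < D i n := fun i n => by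
    have h₁ : ∑ k ∈ Finset.range n, (d i k + 1) ≥ n := by
      simp [Finset.sum_add_distrib]
    simp only [D, Finset.sum_range_succ _ n]
    omega
  have hT : ∀ i, ∃ A ∈ J, ∃ᶠ n in atTop, A ∩ Ico n (D i (D i n)) = ∅ := by
    intro i
    by_contra! hcon
    refine hgap ⟨fun n => D i (D i n), fun A hA => ?_⟩
    simpa only [not_frequently, ← ne_eq, ← nonempty_iff_ne_empty] using hcon A hA
  choose T hTJ hT using hT
  let X : ι → Set ℕ := fun i => thicken (T i) (D i)
  have hX : ∀ i, ∃ᶠ n in atTop, X i ∩ Ico n (D i n) = ∅ := fun i =>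
    (hDs i).tendsto_atTop.frequently
      ((hT i).mono fun n hn => thicken_inter_Ico_eq_empty (hDs i) hn)
  have hXinf : ∀ i, (X i).Infinite := fun i =>
    (hinf _ (hTJ i)).mono fun n hn => ⟨n, hn, le_rfl, (hDlt i n).1⟩
  refine ⟨range X, ?_, ?_, SemifilterSpace.ufinTauAst fun u hu => ?_⟩
  · rintro _ ⟨i, rfl⟩
    exact hXinf i
  · rintro ⟨g, hg⟩
    obtain ⟨i, hi⟩ := hd g
    have hgi := evLE_iff_eventually.1 (hi i (irrefl_of r i))
    obtain ⟨n, hn, hgn, hne⟩ := ((hX i).and_eventually (hgi.and (hg _ (mem_range_self i)))).exists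
    obtain ⟨p, hp, hp'⟩ := hne
    have : p ∈ X i ∩ Ico n (D i n) := ⟨hp, hp'.1, hp'.2.trans_le (hgn.trans (hDlt i n).2.le)⟩
    simp [hn] at this
  · have huniv : Set.univ ∈ upCl (range X) :=
      ⟨_, mem_range_self hι.some, (AlmostSub.refl _).mono_right (subset_univ _)⟩
    choose g hg using fun n => SemifilterSpace.exists_captures_inter_Ico (hu n) huniv n
    choose z hz using fun i n => SemifilterSpace.exists_captures_inter_Ico (hu n)
      (subset_upCl _ (mem_range_self i)) n
    obtain ⟨i₀, hi₀⟩ := hd g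
    obtain ⟨y, hy⟩ := hseg z i₀
    refine ⟨fun n => max (g n) (y n), J, hinf, hlin, ?_⟩
    rintro _ ⟨i, rfl⟩
    refine ⟨T i, hTJ i, ?_⟩
    by_cases hi : r i i₀
    · filter_upwards [evLE_iff_eventually.1 (hy i hi)] with n hn _
      exact (hz i n).mono
        (inter_subset_inter_right _ (Ico_subset_Ico_right (le_max_of_le_right hn)))
    · filter_upwards [evLE_iff_eventually.1 (hi₀ i hi)] with n hn hnT
      refine (hg n).mono fun p hp => ⟨⟨n, hnT, hp.2.1, ?_⟩, hp.2.1, lt_max_of_lt_left hp.2.2⟩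
      exact hp.2.2.trans (hn.trans_lt (hDlt i n).2)

/-- A linearly preordered family without a gap bound yields a space that distinguishes
`Ufin(O,T*)` from `Ufin(O,Γ)`. -/
theorem exists_ufinTauAst_not_ufinGamma {J : Set (Set ℕ)} (hinf : ∀ A ∈ J, A.Infinite)
    (hlin : LinearAlmost J) (hgap : ¬ ∃ g, GapBound g J) :
    ∃ G : Set (Set ℕ), UfinTauAst (SemifilterSpace.{u} G) ∧ ¬ UfinGamma (SemifilterSpace.{u} G) := by
  by_cases hscale : ∃ S : Set (ℕ → ℕ), (∀ a ∈ S, ∀ b ∈ S, evLE a b ∨ evLE b a) ∧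
      ∀ x, ∃ y ∈ S, evLE x y
  · obtain ⟨S, hSlin, hdom⟩ := hscale
    obtain ⟨G, hGinf, hGgap, hG⟩ := exists_thickened_family.{u} hinf hlin hgap hSlin hdom
    exact ⟨G, hG, fun h => hGgap (SemifilterSpace.exists_gapBound_of_ufinGamma hGinf h)⟩
  · exact ⟨J, SemifilterSpace.ufinTauAst_of_not_exists_scale hlin hscale,
      fun h => hgap (SemifilterSpace.exists_gapBound_of_ufinGamma hinf h)⟩

/-- The selection principles `Ufin(O,Γ)` and `Ufin(O,T*)` coincide iff every
semifilter generated by a tower is meager. -/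
theorem stmt_4 :
    (∀ (X : Type u) [TopologicalSpace X], UfinTauAst X → UfinGamma X) ↔
    (∀ (lam : Ordinal) (T : Ordinal → Set ℕ), IsTower lam T →
      MeagerFam (upCl {A | ∃ α < lam, A = T α})) := by
  constructor
  · intro H lam T hT
    rw [meagerFam_upCl_iff]
    by_contra hgap
    have hinf : ∀ A ∈ {A | ∃ α < lam, A = T α}, A.Infinite := by
      rintro _ ⟨α, hα, rfl⟩
      exact hT.1 α hα
    have hlin : LinearAlmost {A | ∃ α < lam, A = T α} := by
      rintro _ ⟨α, hα, rfl⟩ _ ⟨β, hβ, rfl⟩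
      exact (le_total β α).imp (fun h => hT.2 β α h hα) (fun h => hT.2 α β h hβ)
    obtain ⟨G, hG, hG'⟩ := exists_ufinTauAst_not_ufinGamma.{u} hinf hlin hgap
    exact hG' (H _ hG)
  · intro H X _
    refine ufinGamma_of_ufinTauAst fun J hinf hlin => ?_
    obtain ⟨lam, T, hT, hJ⟩ := exists_tower_coinitial hinf hlin
    obtain ⟨g, hg⟩ := meagerFam_upCl_iff.1 (H lam T hT)
    exact ⟨g, fun A hA => hg.upCl A (hJ hA)⟩
end
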